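/- Gradient descent on the propagation objective converges linearly to the unique minimizer: let Z* be the unique solution of (1+η)·Z* + α·L_x Z* + β·Z* L_y = Ŷ + η·Y, and for a step size γ with 0 < γ ≤ 1/M define iterates Z_{t+1} = Z_t − γ·G(Z_t), where G(Z) = (1+η)·Z + α·L_x Z + β·Z L_y − (Ŷ + η·Y). Then 0 ≤ 1 − γ·(1+η) < 1 and for every t ≥ 0, ‖Z_t − Z*‖_F ≤ (1 − γ·(1+η))^t · ‖Z_0 − Z*‖_F; in particular Z_t → Z*. -/

import Mathlib

open Matrix Filter

/-- The gradient `G(Z) = (1+η)·Z + α·L_x Z + β·Z L_y − (Ŷ + η·Y)` of the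
propagation objective. -/
noncomputable def gradLLP {n L : ℕ} (Yhat Y : Matrix (Fin n) (Fin L) ℝ)
    (Lx : Matrix (Fin n) (Fin n) ℝ) (Ly : Matrix (Fin L) (Fin L) ℝ)
    (η α β : ℝ) (Z : Matrix (Fin n) (Fin L) ℝ) : Matrix (Fin n) (Fin L) ℝ :=
  (1 + η) • Z + α • (Lx * Z) + β • (Z * Ly) - (Yhat + η • Y)

open scoped Matrix.Norms.Frobenius in
theorem Matrix.sqrt_trace_transpose_mul_self {m n : Type*} [Fintype m] [Fintype n]
    (A : Matrix m n ℝ) : Real.sqrt (Matrix.trace (Aᵀ * A)) = ‖A‖ := by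
  rw [Matrix.frobenius_norm_def, Real.sqrt_eq_rpow, Finset.sum_comm]
  simp [Matrix.trace, Matrix.mul_apply, sq]

theorem Matrix.abs_entry_le_sqrt_trace {m n : Type*} [Fintype m] [Fintype n]
    (A : Matrix m n ℝ) (i : m) (j : n) :
    |A i j| ≤ Real.sqrt (Matrix.trace (Aᵀ * A)) := by
  apply Real.abs_le_sqrt
  simp only [Matrix.trace, Matrix.diag_apply, Matrix.mul_apply, Matrix.transpose_apply, ← sq]
  calc A i j ^ 2 ≤ ∑ k, A k j ^ 2 :=
        Finset.single_le_sum (f := fun k => A k j ^ 2) (fun _ _ => sq_nonneg _)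
          (Finset.mem_univ i)
    _ ≤ ∑ l, ∑ k, A k l ^ 2 :=
        Finset.single_le_sum (f := fun l => ∑ k, A k l ^ 2)
          (fun _ _ => Finset.sum_nonneg fun _ _ => sq_nonneg _) (Finset.mem_univ j)

/-- If `0 ≤ A ≤ 2` as quadratic forms, then `1 - A` does not increase the Euclidean norm. -/
theorem Matrix.dotProduct_self_sub_mulVec_le {m : Type*} [Fintype m]
    {A : Matrix m m ℝ} (hA : A.IsSymm) (hpsd : ∀ x : m → ℝ, 0 ≤ x ⬝ᵥ A.mulVec x)
    (hbdd : ∀ x : m → ℝ, x ⬝ᵥ A.mulVec x ≤ 2 * (x ⬝ᵥ x)) (x : m → ℝ) :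
    (x - A.mulVec x) ⬝ᵥ (x - A.mulVec x) ≤ x ⬝ᵥ x := by
  have hpos := hpsd (x - (1 / 2 : ℝ) • A.mulVec x)
  have hle := hbdd (A.mulVec x)
  have hself : x ⬝ᵥ A.mulVec (A.mulVec x) = A.mulVec x ⬝ᵥ A.mulVec x := by
    rw [Matrix.dotProduct_mulVec, ← Matrix.mulVec_transpose, hA.eq]
  have hcomm := dotProduct_comm (A.mulVec x) x
  simp only [Matrix.mulVec_sub, Matrix.mulVec_smul, sub_dotProduct, dotProduct_sub,
    smul_dotProduct, dotProduct_smul, smul_eq_mul] at hpos ⊢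
  linarith

section Frobenius

open scoped Matrix.Norms.Frobenius

theorem Matrix.frobenius_norm_sub_mul_le {m n : Type*} [Fintype m] [Fintype n]
    {A : Matrix m m ℝ} (hA : A.IsSymm) (hpsd : ∀ x : m → ℝ, 0 ≤ x ⬝ᵥ A.mulVec x)
    (hbdd : ∀ x : m → ℝ, x ⬝ᵥ A.mulVec x ≤ 2 * (x ⬝ᵥ x)) (E : Matrix m n ℝ) :
    ‖E - A * E‖ ≤ ‖E‖ := by
  rw [← Matrix.sqrt_trace_transpose_mul_self, ← Matrix.sqrt_trace_transpose_mul_self]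
  refine Real.sqrt_le_sqrt (Finset.sum_le_sum fun j _ => ?_)
  exact Matrix.dotProduct_self_sub_mulVec_le hA hpsd hbdd (fun i => E i j)

theorem Matrix.frobenius_norm_sub_mul_le' {m n : Type*} [Fintype m] [Fintype n]
    {A : Matrix n n ℝ} (hA : A.IsSymm) (hpsd : ∀ x : n → ℝ, 0 ≤ x ⬝ᵥ A.mulVec x)
    (hbdd : ∀ x : n → ℝ, x ⬝ᵥ A.mulVec x ≤ 2 * (x ⬝ᵥ x)) (E : Matrix m n ℝ) :
    ‖E - E * A‖ ≤ ‖E‖ := by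
  have h := Matrix.frobenius_norm_sub_mul_le hA hpsd hbdd Eᵀ
  rw [← Matrix.frobenius_norm_transpose (E - E * A), ← Matrix.frobenius_norm_transpose E]
  rwa [Matrix.transpose_sub, Matrix.transpose_mul, hA.eq]

/-- For nonexpansive `E - A * E` and `E - E * B`, the combination
`c • E - a • (A * E) - b • (E * B)` with `a + b ≤ c` has norm at most `c * ‖E‖`. -/
theorem Matrix.frobenius_norm_smul_sub_sub_le {m n : Type*} [Fintype m] [Fintype n]
    {A : Matrix m m ℝ} {B : Matrix n n ℝ} {E : Matrix m n ℝ}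
    (hA : ‖E - A * E‖ ≤ ‖E‖) (hB : ‖E - E * B‖ ≤ ‖E‖) {a b c : ℝ}
    (ha : 0 ≤ a) (hb : 0 ≤ b) (hc : a + b ≤ c) :
    ‖c • E - a • (A * E) - b • (E * B)‖ ≤ c * ‖E‖ := by
  have hsplit : c • E - a • (A * E) - b • (E * B)
      = (c - a - b) • E + a • (E - A * E) + b • (E - E * B) := by module
  have hc' : 0 ≤ c - a - b := by linarith
  rw [hsplit]
  calc ‖(c - a - b) • E + a • (E - A * E) + b • (E - E * B)‖
      ≤ ‖(c - a - b) • E‖ + ‖a • (E - A * E)‖ + ‖b • (E - E * B)‖ := norm_add₃_le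
    _ = (c - a - b) * ‖E‖ + a * ‖E - A * E‖ + b * ‖E - E * B‖ := by
        simp only [norm_smul, Real.norm_of_nonneg ha, Real.norm_of_nonneg hb,
          Real.norm_of_nonneg hc']
    _ ≤ (c - a - b) * ‖E‖ + a * ‖E‖ + b * ‖E‖ := by gcongr
    _ = c * ‖E‖ := by ring

end Frobenius

/-- Gradient descent on the propagation objective converges linearly to the unique
minimizer `Z*`: with step size `0 < γ ≤ 1/M`, `M = (1+η) + 2α + 2β`, one has
`0 ≤ 1 − γ(1+η) < 1` and `‖Z_t − Z*‖_F ≤ (1 − γ(1+η))^t ‖Z_0 − Z*‖_F`, so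
`Z_t → Z*`. -/
theorem LLP_gradient_descent_linear_convergence
    (n L : ℕ) (Yhat Y : Matrix (Fin n) (Fin L) ℝ)
    (Lx : Matrix (Fin n) (Fin n) ℝ) (Ly : Matrix (Fin L) (Fin L) ℝ)
    (η α β : ℝ)
    (hLx_symm : Lx.IsSymm) (hLx_psd : ∀ x : Fin n → ℝ, 0 ≤ x ⬝ᵥ Lx.mulVec x)
    (hLy_symm : Ly.IsSymm) (hLy_psd : ∀ u : Fin L → ℝ, 0 ≤ u ⬝ᵥ Ly.mulVec u)
    (hη : 0 ≤ η) (hα : 0 ≤ α) (hβ : 0 ≤ β)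
    (hLx_bdd : ∀ x : Fin n → ℝ, x ⬝ᵥ Lx.mulVec x ≤ 2 * (x ⬝ᵥ x))
    (hLy_bdd : ∀ u : Fin L → ℝ, u ⬝ᵥ Ly.mulVec u ≤ 2 * (u ⬝ᵥ u))
    (Zstar : Matrix (Fin n) (Fin L) ℝ)
    (hZstar : (1 + η) • Zstar + α • (Lx * Zstar) + β • (Zstar * Ly) = Yhat + η • Y)
    (γ : ℝ) (hγ_pos : 0 < γ) (hγ_le : γ ≤ 1 / ((1 + η) + 2 * α + 2 * β))
    (Zseq : ℕ → Matrix (Fin n) (Fin L) ℝ)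
    (hstep : ∀ t : ℕ, Zseq (t + 1) = Zseq t - γ • gradLLP Yhat Y Lx Ly η α β (Zseq t)) :
    0 ≤ 1 - γ * (1 + η) ∧ 1 - γ * (1 + η) < 1 ∧
      (∀ t : ℕ,
        Real.sqrt (Matrix.trace ((Zseq t - Zstar)ᵀ * (Zseq t - Zstar)))
          ≤ (1 - γ * (1 + η)) ^ t
              * Real.sqrt (Matrix.trace ((Zseq 0 - Zstar)ᵀ * (Zseq 0 - Zstar)))) ∧
      Tendsto Zseq atTop (nhds Zstar) := by
  have hM : 0 < (1 + η) + 2 * α + 2 * β := by positivity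
  have hγM : γ * ((1 + η) + 2 * α + 2 * β) ≤ 1 := (le_div_iff₀ hM).mp hγ_le
  have hγα : 0 ≤ γ * α := by positivity
  have hγβ : 0 ≤ γ * β := by positivity
  have hγη : 0 < γ * (1 + η) := by positivity
  have hc : γ * α + γ * β ≤ 1 - γ * (1 + η) := by linarith
  have hc0 : 0 ≤ 1 - γ * (1 + η) := by linarith
  have hc1 : 1 - γ * (1 + η) < 1 := by linarith
  have herr (t : ℕ) : Zseq (t + 1) - Zstar = (1 - γ * (1 + η)) • (Zseq t - Zstar)
      - (γ * α) • (Lx * (Zseq t - Zstar)) - (γ * β) • ((Zseq t - Zstar) * Ly) := by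
    rw [hstep, gradLLP, ← hZstar, Matrix.mul_sub, Matrix.sub_mul]
    module
  have hrate (t : ℕ) : Real.sqrt (Matrix.trace ((Zseq t - Zstar)ᵀ * (Zseq t - Zstar)))
      ≤ (1 - γ * (1 + η)) ^ t
        * Real.sqrt (Matrix.trace ((Zseq 0 - Zstar)ᵀ * (Zseq 0 - Zstar))) := by
    induction t with
    | zero => simp
    | succ t ih =>
      rw [pow_succ', mul_assoc]
      refine le_trans ?_ (mul_le_mul_of_nonneg_left ih hc0)
      rw [Matrix.sqrt_trace_transpose_mul_self, Matrix.sqrt_trace_transpose_mul_self, herr]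
      exact Matrix.frobenius_norm_smul_sub_sub_le
        (Matrix.frobenius_norm_sub_mul_le hLx_symm hLx_psd hLx_bdd _)
        (Matrix.frobenius_norm_sub_mul_le' hLy_symm hLy_psd hLy_bdd _) hγα hγβ hc
  refine ⟨hc0, hc1, hrate, ?_⟩
  refine tendsto_pi_nhds.mpr fun i => tendsto_pi_nhds.mpr fun j => ?_
  refine tendsto_iff_norm_sub_tendsto_zero.mpr ?_
  refine squeeze_zero (fun _ => norm_nonneg _)
    (fun t => (Matrix.abs_entry_le_sqrt_trace (Zseq t - Zstar) i j).trans (hrate t)) ?_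
  simpa using (tendsto_pow_atTop_nhds_zero_of_lt_one hc0 hc1).mul_const
    (Real.sqrt (Matrix.trace ((Zseq 0 - Zstar)ᵀ * (Zseq 0 - Zstar))))
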